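/- Let K ≥ 1 and let z_1, ..., z_K be vectors in ℝ^K, each lying in the standard simplex (all coordinates nonnegative and the coordinates sum to 1). Suppose that for all i ≠ j the cosine similarity of z_i and z_j is zero, i.e., ⟨z_i, z_j⟩ / (‖z_i‖‖z_j‖) = 0. Then each z_i is one-hot: for each i there is exactly one coordinate k with (z_i)_k = 1 and all other coordinates of z_i equal to 0; moreover, the map sending each i to the index of its nonzero coordinate is a bijection of {1, ..., K}. -/

import Mathlib

open scoped RealInnerProductSpace

/-- If `z 1, ..., z K` are `K` vectors of the standard simplex in `ℝ^K` whose pairwise cosine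
similarities all vanish, then each `z i` is a one-hot vector, and the assignment of each `i`
to the index of its nonzero coordinate is a bijection. -/
theorem one_hot_of_orthogonal_simplex
    (K : ℕ) (hK : 1 ≤ K) (z : Fin K → EuclideanSpace ℝ (Fin K))
    (hnonneg : ∀ i k, 0 ≤ z i k)
    (hsum : ∀ i, ∑ k, z i k = 1)
    (hcos : ∀ i j, i ≠ j → ⟪z i, z j⟫ / (‖z i‖ * ‖z j‖) = 0) :
    ∃ σ : Fin K → Fin K, Function.Bijective σ ∧
      ∀ i, z i (σ i) = 1 ∧ ∀ k, k ≠ σ i → z i k = 0 := by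
  have hne : ∀ i, z i ≠ 0 := by
    intro i h
    have := hsum i
    simp [h] at this
  have hprod : ∀ i j, i ≠ j → ∀ k, z i k * z j k = 0 := by
    intro i j hij k
    have h := hcos i j hij
    have hn : ‖z i‖ * ‖z j‖ ≠ 0 :=
      mul_ne_zero (norm_ne_zero_iff.2 (hne i)) (norm_ne_zero_iff.2 (hne j))
    have h0 : ⟪z i, z j⟫ = 0 := (div_eq_zero_iff.1 h).resolve_right hn
    have h1 : ∑ k, z i k * z j k = 0 := by
      rw [← h0, PiLp.inner_apply]
      simp [mul_comm]
    exact (Finset.sum_eq_zero_iff_of_nonneg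
      (fun k _ => mul_nonneg (hnonneg i k) (hnonneg j k))).1 h1 k (Finset.mem_univ k)
  have hex : ∀ i, ∃ k, z i k ≠ 0 := by
    intro i
    by_contra! h
    have := hsum i
    simp [h] at this
  choose σ hσ using hex
  have hinj : Function.Injective σ := by
    intro i j hij
    by_contra hne'
    rcases mul_eq_zero.1 (hprod i j hne' (σ i)) with h | h
    · exact hσ i h
    · rw [hij] at h
      exact hσ j h
  have hbij : Function.Bijective σ := Finite.injective_iff_bijective.1 hinj
  have hz : ∀ i k, k ≠ σ i → z i k = 0 := by
    intro i k hk
    obtain ⟨j, rfl⟩ := hbij.2 k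
    have hij : i ≠ j := fun h => hk (by rw [h])
    exact (mul_eq_zero.1 (hprod i j hij (σ j))).resolve_right (hσ j)
  refine ⟨σ, hbij, fun i => ⟨?_, hz i⟩⟩
  rw [← hsum i]
  exact (Finset.sum_eq_single (σ i) (fun k _ hk => hz i k hk) (by simp)).symm
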